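/- Let B ⊂ ℝ^n be a ball centered at 0 and let u(x) = (1/2)·x_n² for x_n > 0, u(x) = 0 for x_n ≤ 0. Then for every v ∈ H²(B) with v − u ∈ H₀²(B) one has F(u,B) ≤ F(v,B), and equality holds if and only if v = u in B. -/

import Mathlib

open MeasureTheory Metric Set Filter Topology
open scoped ENNReal

noncomputable section

/-- `n`-dimensional Euclidean space. -/
abbrev RH (n : ℕ) := EuclideanSpace ℝ (Fin n)

variable {n : ℕ}

/-- Smooth compactly supported test functions with support contained in `Ω`. -/
def IsTestFun (Ω : Set (RH n)) (φ : RH n → ℝ) : Prop :=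
  ContDiff ℝ (⊤ : ℕ∞) φ ∧ HasCompactSupport φ ∧ tsupport φ ⊆ Ω

/-- Classical partial derivative in the `i`-th coordinate direction. -/
def cpderiv (i : Fin n) (φ : RH n → ℝ) : RH n → ℝ :=
  fun x => fderiv ℝ φ x (EuclideanSpace.single i 1)

/-- Classical Laplacian of a (smooth) function. -/
def cLaplacian (φ : RH n → ℝ) : RH n → ℝ :=
  fun x => ∑ i, cpderiv i (cpderiv i φ) x

/-- `g` is the weak `i`-th partial derivative of `u` on `Ω`. -/
def IsWeakPartial (Ω : Set (RH n)) (i : Fin n) (u g : RH n → ℝ) : Prop :=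
  ∀ φ : RH n → ℝ, IsTestFun Ω φ →
    ∫ x in Ω, u x * cpderiv i φ x = - ∫ x in Ω, g x * φ x

/-- `g` is a weak Laplacian of `u` on `Ω`. -/
def IsWeakLaplacian (Ω : Set (RH n)) (u g : RH n → ℝ) : Prop :=
  ∀ φ : RH n → ℝ, IsTestFun Ω φ →
    ∫ x in Ω, u x * cLaplacian φ x = ∫ x in Ω, g x * φ x

/-- `u ∈ H²(Ω)` with weak gradient `g` and weak Hessian `h`. -/
def IsH2With (Ω : Set (RH n)) (u : RH n → ℝ) (g : Fin n → RH n → ℝ)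
    (h : Fin n → Fin n → RH n → ℝ) : Prop :=
  MemLp u 2 (volume.restrict Ω) ∧
  (∀ i, IsWeakPartial Ω i u (g i) ∧ MemLp (g i) 2 (volume.restrict Ω)) ∧
  (∀ i j, IsWeakPartial Ω j (g i) (h i j) ∧ MemLp (h i j) 2 (volume.restrict Ω))

/-- `u ∈ H²(Ω)`. -/
def MemH2 (Ω : Set (RH n)) (u : RH n → ℝ) : Prop :=
  ∃ g h, IsH2With Ω u g h

/-- `u ∈ H₀²(Ω)`: `u ∈ H²(Ω)` and `u` is approximable in the `H²`-norm by
test functions supported in `Ω`. -/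
def MemH20 (Ω : Set (RH n)) (u : RH n → ℝ) : Prop :=
  ∃ g h, IsH2With Ω u g h ∧
    ∃ φ : ℕ → RH n → ℝ, (∀ k, IsTestFun Ω (φ k)) ∧
      Tendsto (fun k => eLpNorm (fun x => u x - φ k x) 2 (volume.restrict Ω)) atTop (𝓝 0) ∧
      (∀ i, Tendsto (fun k => eLpNorm (fun x => g i x - cpderiv i (φ k) x) 2
        (volume.restrict Ω)) atTop (𝓝 0)) ∧
      (∀ i j, Tendsto (fun k => eLpNorm (fun x => h i j x - cpderiv j (cpderiv i (φ k)) x) 2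
        (volume.restrict Ω)) atTop (𝓝 0))

/-- `u ∈ H²_loc(ℝⁿ)`. -/
def MemH2loc (u : RH n → ℝ) : Prop :=
  ∀ Ω : Set (RH n), IsOpen Ω → Bornology.IsBounded Ω → MemH2 Ω u

/-- The two-sided biharmonic Alt–Caffarelli functional
`F(u,Ω) = ∫_Ω (Δu)² dx + |{x ∈ Ω : u x ≠ 0}|`, where the (weak) Laplacian
`Δu = lapu` is given explicitly. -/
def ACF (Ω : Set (RH n)) (lapu u : RH n → ℝ) : ℝ :=
  (∫ x in Ω, (lapu x) ^ 2) + (volume {x ∈ Ω | u x ≠ 0}).toReal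

/-- `u` is a global minimizer of the two-sided biharmonic Alt–Caffarelli functional. -/
def IsGlobalMinimizer (u : RH n → ℝ) : Prop :=
  MemH2loc u ∧
  ∀ Ω : Set (RH n), IsOpen Ω → Bornology.IsBounded Ω →
    ∀ v : RH n → ℝ, MemH2 Ω v → MemH20 Ω (fun x => v x - u x) →
      ∀ lapu lapv : RH n → ℝ, IsWeakLaplacian Ω u lapu → IsWeakLaplacian Ω v lapv →
        ACF Ω lapu u ≤ ACF Ω lapv v


/-- The half-space function `u(x) = ½ xₙ² 𝟙_{xₙ>0}`. -/
def uHalf (n : ℕ) (hn : 0 < n) : RH n → ℝ := fun x =>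
  if 0 < x ⟨n - 1, by omega⟩ then (x ⟨n - 1, by omega⟩) ^ 2 / 2 else 0

/-! ### Convergence in `L²` -/

/-- `fk → f` in `L²(μ)`. -/
structure L2Tendsto {α : Type*} [MeasurableSpace α] (μ : Measure α)
    (fk : ℕ → α → ℝ) (f : α → ℝ) : Prop where
  memLp_lim : MemLp f 2 μ
  memLp : ∀ k, MemLp (fk k) 2 μ
  tendsto : Tendsto (fun k => eLpNorm (fun x => f x - fk k x) 2 μ) atTop (𝓝 0)

namespace L2Tendsto

variable {α : Type*} [MeasurableSpace α] {μ : Measure α} {fk gk : ℕ → α → ℝ} {f g : α → ℝ}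

lemma const (hf : MemLp f 2 μ) : L2Tendsto μ (fun _ => f) f :=
  ⟨hf, fun _ => hf, by simp⟩

lemma tendsto_toLp (hf : L2Tendsto μ fk f) :
    Tendsto (fun k => (hf.memLp k).toLp (fk k)) atTop (𝓝 (hf.memLp_lim.toLp f)) := by
  rw [Lp.tendsto_Lp_iff_tendsto_eLpNorm'']
  refine hf.tendsto.congr fun k => ?_
  rw [eLpNorm_sub_comm]
  rfl

lemma integral_mul (hf : L2Tendsto μ fk f) (hg : L2Tendsto μ gk g) :
    Tendsto (fun k => ∫ x, fk k x * gk k x ∂μ) atTop (𝓝 (∫ x, f x * g x ∂μ)) := by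
  have key : ∀ {a b : α → ℝ} (ha : MemLp a 2 μ) (hb : MemLp b 2 μ),
      inner ℝ (hb.toLp b) (ha.toLp a) = ∫ x, a x * b x ∂μ := by
    intro a b ha hb
    rw [L2.inner_def]
    refine integral_congr_ae ?_
    filter_upwards [ha.coeFn_toLp, hb.coeFn_toLp] with x h1 h2
    rw [h1, h2]
    rfl
  have := hg.tendsto_toLp.inner (𝕜 := ℝ) hf.tendsto_toLp
  simpa only [key] using this

lemma of_le_mul {h : α → ℝ} {hk : ℕ → α → ℝ} (hf : L2Tendsto μ fk f) (c : ℝ)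
    (hh : MemLp h 2 μ) (hhk : ∀ k, MemLp (hk k) 2 μ)
    (hle : ∀ k x, |h x - hk k x| ≤ c * |f x - fk k x|) : L2Tendsto μ hk h := by
  refine ⟨hh, hhk, ?_⟩
  have h0 : Tendsto (fun k => ENNReal.ofReal c * eLpNorm (fun x => f x - fk k x) 2 μ) atTop
      (𝓝 0) := by
    simpa using ENNReal.Tendsto.const_mul hf.tendsto (Or.inr ENNReal.ofReal_ne_top)
  refine tendsto_of_tendsto_of_tendsto_of_le_of_le tendsto_const_nhds h0 (fun _ => zero_le)
    fun k => ?_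
  exact eLpNorm_le_mul_eLpNorm_of_ae_le_mul (ae_of_all _ fun x => by simpa using hle k x) 2

lemma add (hf : L2Tendsto μ fk f) (hg : L2Tendsto μ gk g) :
    L2Tendsto μ (fun k x => fk k x + gk k x) (fun x => f x + g x) := by
  refine ⟨hf.memLp_lim.add hg.memLp_lim, fun k => (hf.memLp k).add (hg.memLp k), ?_⟩
  have h0 := hf.tendsto.add hg.tendsto
  rw [add_zero] at h0
  refine tendsto_of_tendsto_of_tendsto_of_le_of_le tendsto_const_nhds h0 (fun _ => zero_le)
    fun k => ?_
  have := eLpNorm_add_le (hf.memLp_lim.sub (hf.memLp k)).1 (hg.memLp_lim.sub (hg.memLp k)).1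
    (p := 2) (by norm_num)
  refine le_trans (le_of_eq ?_) this
  congr 1
  funext x
  simp only [Pi.add_apply, Pi.sub_apply]
  ring

lemma sum {ι : Type*} (s : Finset ι) {fk : ι → ℕ → α → ℝ} {f : ι → α → ℝ}
    (h : ∀ i, L2Tendsto μ (fk i) (f i)) :
    L2Tendsto μ (fun k x => ∑ i ∈ s, fk i k x) (fun x => ∑ i ∈ s, f i x) := by
  classical
  induction s using Finset.induction_on with
  | empty => simpa using const (μ := μ) (f := fun _ => (0 : ℝ)) MemLp.zero'
  | insert a s ha ih => simpa only [Finset.sum_insert ha] using (h a).add ih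

lemma mul_bounded {p : α → ℝ} {C : ℝ} (hf : L2Tendsto μ fk f) (hp : AEStronglyMeasurable p μ)
    (hC : ∀ x, |p x| ≤ C) : L2Tendsto μ (fun k x => fk k x * p x) (fun x => f x * p x) := by
  have key : ∀ {q : α → ℝ}, MemLp q 2 μ → MemLp (fun x => q x * p x) 2 μ := fun hq =>
    hq.of_le_mul (c := C) (hq.1.mul hp) (ae_of_all _ fun x => by
      rw [norm_mul, mul_comm]
      exact mul_le_mul_of_nonneg_right (hC x) (norm_nonneg _))
  refine hf.of_le_mul C (key hf.memLp_lim) (fun k => key (hf.memLp k)) fun k x => ?_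
  rw [← sub_mul, abs_mul, mul_comm]
  exact mul_le_mul_of_nonneg_right (hC x) (abs_nonneg _)

lemma comp_lipschitz [IsFiniteMeasure μ] {F : ℝ → ℝ} {L : ℝ} (hf : L2Tendsto μ fk f)
    (hF : ∀ s t, |F s - F t| ≤ L * |s - t|) :
    L2Tendsto μ (fun k x => F (fk k x)) (fun x => F (f x)) := by
  have hc : Continuous F := (LipschitzWith.of_dist_le' (K := L) hF).continuous
  have key : ∀ {q : α → ℝ}, MemLp q 2 μ → MemLp (fun x => F (q x)) 2 μ := by
    intro q hq
    have h1 : MemLp (fun x => F (q x) - F 0) 2 μ :=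
      hq.of_le_mul (c := L) ((hc.comp_aestronglyMeasurable hq.1).sub aestronglyMeasurable_const)
        (ae_of_all _ fun x => by simpa using hF (q x) 0)
    convert h1.add (memLp_const (F 0)) using 1
    funext x
    simp
  exact hf.of_le_mul L (key hf.memLp_lim) (fun k => key (hf.memLp k)) fun k x => hF _ _

end L2Tendsto

/-! ### Test functions -/

namespace IsTestFun

variable {Ω : Set (RH n)} {φ ψ : RH n → ℝ}

lemma differentiable (hφ : IsTestFun Ω φ) : Differentiable ℝ φ :=
  hφ.1.differentiable (by simp)

lemma continuous (hφ : IsTestFun Ω φ) : Continuous φ := hφ.1.continuous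

lemma cpderiv (hφ : IsTestFun Ω φ) (i : Fin n) : IsTestFun Ω (cpderiv i φ) := by
  refine ⟨?_, hφ.2.1.fderiv_apply ℝ _, (tsupport_fderiv_apply_subset ℝ _).trans hφ.2.2⟩
  have h : ContDiff ℝ (⊤ : ℕ∞) (fderiv ℝ φ) := hφ.1.fderiv_right (by simp)
  exact h.clm_apply contDiff_const

lemma zero : IsTestFun Ω (fun _ => (0 : ℝ)) := by
  refine ⟨contDiff_const, HasCompactSupport.zero, ?_⟩
  have : tsupport (fun _ : RH n => (0 : ℝ)) = ∅ := by simp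
  simp [this]

lemma add (hφ : IsTestFun Ω φ) (hψ : IsTestFun Ω ψ) : IsTestFun Ω (fun x => φ x + ψ x) :=
  ⟨hφ.1.add hψ.1, hφ.2.1.add hψ.2.1,
    (tsupport_add φ ψ).trans (union_subset hφ.2.2 hψ.2.2)⟩

lemma eq_zero_of_notMem (hφ : IsTestFun Ω φ) {x : RH n} (hx : x ∉ Ω) : φ x = 0 :=
  image_eq_zero_of_notMem_tsupport fun h => hx (hφ.2.2 h)

lemma exists_bound (hφ : IsTestFun Ω φ) : ∃ C, ∀ x, |φ x| ≤ C :=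
  hφ.2.1.exists_bound_of_continuous hφ.continuous

lemma memLp (hφ : IsTestFun Ω φ) {p : ℝ≥0∞} : MemLp φ p (volume.restrict Ω) :=
  (hφ.continuous.memLp_of_hasCompactSupport hφ.2.1).restrict Ω

lemma hasLineDerivAt (hφ : IsTestFun Ω φ) (i : Fin n) (x : RH n) :
    HasLineDerivAt ℝ φ (_root_.cpderiv i φ x) x (EuclideanSpace.single i 1) :=
  (hφ.differentiable x).hasFDerivAt.hasLineDerivAt _

lemma setIntegral_mul (hφ : IsTestFun Ω φ) (f : RH n → ℝ) :
    ∫ x in Ω, f x * φ x = ∫ x, f x * φ x :=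
  setIntegral_eq_integral_of_forall_compl_eq_zero fun x hx => by
    rw [hφ.eq_zero_of_notMem hx, mul_zero]

lemma integrable_mul (hφ : IsTestFun Ω φ) {f : RH n → ℝ} (hf : Continuous f) :
    Integrable (fun x => f x * φ x) :=
  (hf.mul hφ.continuous).integrable_of_hasCompactSupport hφ.2.1.mul_left

/-- Integration by parts against a test function. -/
lemma integral_mul_cpderiv (hφ : IsTestFun Ω φ) {i : Fin n} {f g : RH n → ℝ}
    (hf : Continuous f) (hg : Continuous g)
    (hfg : ∀ x, HasLineDerivAt ℝ f (g x) x (EuclideanSpace.single i 1)) :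
    ∫ x in Ω, f x * _root_.cpderiv i φ x = - ∫ x in Ω, g x * φ x := by
  rw [(hφ.cpderiv i).setIntegral_mul, hφ.setIntegral_mul]
  exact integral_bilinear_hasLineDerivAt_right_eq_neg_left_of_integrable
    (B := ContinuousLinearMap.mul ℝ ℝ) (hφ.integrable_mul hg)
    ((hφ.cpderiv i).integrable_mul hf) (hφ.integrable_mul hf) (fun x _ => hfg x)
    (fun x _ => hφ.hasLineDerivAt i x)

/-- Integration by parts of a Lipschitz function against a test function. -/
lemma integral_mul_cpderiv_of_lipschitz (hφ : IsTestFun Ω φ) {i : Fin n} {f g : RH n → ℝ}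
    {C : NNReal} (hf : LipschitzWith C f)
    (hfg : ∀ᵐ x, HasLineDerivAt ℝ f (g x) x (EuclideanSpace.single i 1)) :
    ∫ x in Ω, f x * _root_.cpderiv i φ x = - ∫ x in Ω, g x * φ x := by
  rw [(hφ.cpderiv i).setIntegral_mul, hφ.setIntegral_mul]
  obtain ⟨D, hD⟩ := ContDiff.lipschitzWith_of_hasCompactSupport hφ.2.1 hφ.1 (by simp)
  have h := hf.integral_lineDeriv_mul_eq (μ := volume) hD hφ.2.1 (EuclideanSpace.single i 1)
  have h1 : ∫ x, g x * φ x = ∫ x, lineDeriv ℝ f x (EuclideanSpace.single i 1) * φ x :=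
    integral_congr_ae <| by
      filter_upwards [hfg] with x hx
      rw [hx.lineDeriv]
  rw [h1, h, ← integral_neg]
  refine integral_congr_ae (ae_of_all _ fun x => ?_)
  simp only [lineDeriv_neg, (hφ.hasLineDerivAt i x).lineDeriv]
  ring

end IsTestFun

/-- A locally integrable function that integrates to zero against all test functions vanishes
almost everywhere. -/
lemma ae_eq_zero_of_forall_test {Ω : Set (RH n)} (hΩ : IsOpen Ω) {f : RH n → ℝ}
    (hf : LocallyIntegrableOn f Ω)
    (h : ∀ φ, IsTestFun Ω φ → ∫ x in Ω, f x * φ x = 0) :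
    ∀ᵐ x ∂volume.restrict Ω, f x = 0 := by
  rw [ae_restrict_iff' hΩ.measurableSet]
  refine hΩ.ae_eq_zero_of_integral_contDiff_smul_eq_zero hf fun φ h1 h2 h3 => ?_
  have hφ : IsTestFun Ω φ := ⟨h1, h2, h3⟩
  rw [← h φ hφ, hφ.setIntegral_mul]
  simp only [smul_eq_mul, mul_comm]

/-! ### Chain rule for weak derivatives -/

/-- `g` is a weak `i`-th partial derivative of `f` on `Ω`, in the sense that the chain rule holds
for compositions of `f` with functions having bounded and Lipschitz derivative. -/
def HasChainRule (Ω : Set (RH n)) (i : Fin n) (f g : RH n → ℝ) : Prop :=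
  ∀ (F F' : ℝ → ℝ) (L : ℝ), (∀ t, HasDerivAt F (F' t) t) → (∀ t, |F' t| ≤ 1) →
    (∀ s t, |F' s - F' t| ≤ L * |s - t|) → ∀ φ, IsTestFun Ω φ →
      ∫ x in Ω, F (f x) * cpderiv i φ x = - ∫ x in Ω, F' (f x) * g x * φ x

lemma abs_sub_le_of_deriv_le_one {F F' : ℝ → ℝ} (hF : ∀ t, HasDerivAt F (F' t) t)
    (hF' : ∀ t, |F' t| ≤ 1) (s t : ℝ) : |F s - F t| ≤ 1 * |s - t| :=
  Convex.norm_image_sub_le_of_norm_hasDerivWithin_le (fun x _ => (hF x).hasDerivWithinAt)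
    (fun x _ => hF' x) convex_univ (mem_univ t) (mem_univ s)

lemma HasLineDerivAt.scomp_real {F : ℝ → ℝ} {F₀ g₀ : ℝ} {f : RH n → ℝ} {x v : RH n}
    (hF : HasDerivAt F F₀ (f x)) (hf : HasLineDerivAt ℝ f g₀ x v) :
    HasLineDerivAt ℝ (fun y => F (f y)) (F₀ * g₀) x v := by
  have hF' : HasDerivAt F F₀ (f (x + (0 : ℝ) • v)) := by simpa using hF
  exact HasDerivAt.comp (0 : ℝ) (h := fun t : ℝ => f (x + t • v)) hF' hf

namespace HasChainRule

variable {Ω : Set (RH n)} {i : Fin n} {f g : RH n → ℝ}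

lemma of_hasLineDerivAt (hf : Continuous f) (hg : Continuous g)
    (hfg : ∀ x, HasLineDerivAt ℝ f (g x) x (EuclideanSpace.single i 1)) :
    HasChainRule Ω i f g := by
  intro F F' L hF _ hL φ hφ
  have hc : Continuous F := continuous_iff_continuousAt.2 fun t => (hF t).continuousAt
  have hc' : Continuous F' := (LipschitzWith.of_dist_le' (K := L) hL).continuous
  exact hφ.integral_mul_cpderiv (hc.comp hf) ((hc'.comp hf).mul hg)
    fun x => HasLineDerivAt.scomp_real (hF _) (hfg x)

lemma of_lipschitz {C : NNReal} (hf : LipschitzWith C f)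
    (hfg : ∀ᵐ x, HasLineDerivAt ℝ f (g x) x (EuclideanSpace.single i 1)) :
    HasChainRule Ω i f g := by
  intro F F' L hF hF' hL φ hφ
  have hc : LipschitzWith (Real.toNNReal 1) F :=
    LipschitzWith.of_dist_le' (abs_sub_le_of_deriv_le_one hF hF')
  refine hφ.integral_mul_cpderiv_of_lipschitz (hc.comp hf) ?_
  filter_upwards [hfg] with x hx
  exact HasLineDerivAt.scomp_real (hF _) hx

lemma of_tendsto [IsFiniteMeasure (volume.restrict Ω)] {fk gk : ℕ → RH n → ℝ}
    (h : ∀ k, HasChainRule Ω i (fk k) (gk k))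
    (hf : L2Tendsto (volume.restrict Ω) fk f) (hg : L2Tendsto (volume.restrict Ω) gk g) :
    HasChainRule Ω i f g := by
  intro F F' L hF hF' hL φ hφ
  have h1 := (hf.comp_lipschitz (abs_sub_le_of_deriv_le_one hF hF')).integral_mul
    (L2Tendsto.const (hφ.cpderiv i).memLp)
  obtain ⟨C, hC⟩ := hφ.exists_bound
  have h2 := ((hf.comp_lipschitz hL).integral_mul
    (hg.mul_bounded hφ.continuous.aestronglyMeasurable hC)).neg
  refine tendsto_nhds_unique h1 ?_
  have e : ∀ a b : RH n → ℝ, ∫ x in Ω, F' (a x) * b x * φ x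
      = ∫ x in Ω, F' (a x) * (b x * φ x) := fun a b => by simp only [mul_assoc]
  rw [e]
  refine h2.congr fun k => ?_
  rw [h k F F' L hF hF' hL φ hφ, e]

lemma integral_mul_cpderiv (h : HasChainRule Ω i f g) {φ : RH n → ℝ} (hφ : IsTestFun Ω φ) :
    ∫ x in Ω, f x * cpderiv i φ x = - ∫ x in Ω, g x * φ x := by
  simpa using h (fun t => t) (fun _ => 1) 0 (fun t => hasDerivAt_id t) (by simp) (by simp) φ hφ

/-- The weak derivative of `f` vanishes almost everywhere on the zero set of `f`. -/
lemma ae_eq_zero [IsFiniteMeasure (volume.restrict Ω)] (hΩ : IsOpen Ω)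
    (h : HasChainRule Ω i f g) (hf : MemLp f 2 (volume.restrict Ω))
    (hg : MemLp g 2 (volume.restrict Ω)) :
    ∀ᵐ x ∂volume.restrict Ω, f x = 0 → g x = 0 := by
  have hgi : Integrable g (volume.restrict Ω) := hg.integrable (by norm_num)
  set q : RH n → ℝ := fun x => (if f x = 0 then 1 else 0) * g x with hq
  have hF (m : ℕ) (t : ℝ) : HasDerivAt (fun s => Real.arctan ((m + 1 : ℝ) * s) / (m + 1))
      (1 / (1 + ((m + 1 : ℝ) * t) ^ 2)) t := by
    have hm : (m + 1 : ℝ) ≠ 0 := by positivity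
    have h0 : HasDerivAt (fun s : ℝ => (m + 1 : ℝ) * s) (m + 1) t := by
      simpa using (hasDerivAt_id t).const_mul (m + 1 : ℝ)
    refine (h0.arctan.div_const (m + 1 : ℝ)).congr_deriv ?_
    field_simp
  have hF' (m : ℕ) (t : ℝ) : |1 / (1 + ((m + 1 : ℝ) * t) ^ 2)| ≤ 1 := by
    rw [abs_of_nonneg (by positivity), div_le_one (by positivity)]
    nlinarith [sq_nonneg ((m + 1 : ℝ) * t)]
  have hL (m : ℕ) (s t : ℝ) : |1 / (1 + ((m + 1 : ℝ) * s) ^ 2) - 1 / (1 + ((m + 1 : ℝ) * t) ^ 2)|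
      ≤ (m + 1) * |s - t| := by
    have hm : (0 : ℝ) < m + 1 := by positivity
    have key : ∀ a b : ℝ, |1 / (1 + a ^ 2) - 1 / (1 + b ^ 2)| ≤ |a - b| := by
      intro a b
      have e : 1 / (1 + a ^ 2) - 1 / (1 + b ^ 2)
          = (a - b) * (-(a + b) / ((1 + a ^ 2) * (1 + b ^ 2))) := by
        field_simp
        ring
      rw [e, abs_mul]
      refine mul_le_of_le_one_right (abs_nonneg _) ?_
      rw [abs_div, abs_neg, abs_of_pos (by positivity : (0 : ℝ) < (1 + a ^ 2) * (1 + b ^ 2)),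
        div_le_one (by positivity), abs_le]
      constructor <;>
        nlinarith [sq_nonneg (a - 1), sq_nonneg (b - 1), sq_nonneg (a + 1), sq_nonneg (b + 1),
          mul_nonneg (sq_nonneg a) (sq_nonneg b)]
    refine (key _ _).trans (le_of_eq ?_)
    rw [← mul_sub, abs_mul, abs_of_pos hm]
  have hqm : AEStronglyMeasurable q (volume.restrict Ω) := by
    have h1 : AEMeasurable (fun x => if f x = 0 then (1 : ℝ) else 0) (volume.restrict Ω) :=
      (Measurable.ite (p := fun t : ℝ => t = 0) (measurableSet_singleton 0) measurable_const
        measurable_const).comp_aemeasurable hf.1.aemeasurable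
    exact h1.aestronglyMeasurable.mul hg.1
  have hqi : Integrable q (volume.restrict Ω) := by
    refine hgi.mono hqm (ae_of_all _ fun x => ?_)
    by_cases hx : f x = 0 <;> simp [hq, hx]
  have hq0 := ae_eq_zero_of_forall_test hΩ
    (IntegrableOn.locallyIntegrableOn (s := Ω) hqi) fun φ hφ => by
    obtain ⟨C, hC⟩ := hφ.exists_bound
    have l1 : Tendsto (fun m : ℕ => ∫ x in Ω,
        Real.arctan ((m + 1 : ℝ) * f x) / (m + 1) * cpderiv i φ x) atTop (𝓝 (∫ x in Ω, 0)) := by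
      refine tendsto_integral_of_dominated_convergence (fun x => 2 * |cpderiv i φ x|) ?_ ?_ ?_ ?_
      · intro m
        refine AEStronglyMeasurable.mul ?_ (hφ.cpderiv i).continuous.aestronglyMeasurable
        refine Continuous.comp_aestronglyMeasurable
          (g := fun t : ℝ => Real.arctan ((m + 1 : ℝ) * t) / (m + 1)) ?_ hf.1
        exact (Real.continuous_arctan.comp (continuous_const.mul continuous_id)).div_const _
      · exact ((hφ.cpderiv i).memLp.integrable le_rfl).abs.const_mul 2
      · refine fun m => ae_of_all _ fun x => ?_
        rw [norm_mul]
        refine mul_le_mul_of_nonneg_right ?_ (norm_nonneg _)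
        rw [Real.norm_eq_abs, abs_div, abs_of_pos (by positivity : (0 : ℝ) < m + 1),
          div_le_iff₀ (by positivity)]
        have h1 : |Real.arctan ((m + 1 : ℝ) * f x)| ≤ 2 := by
          rw [abs_le]
          constructor <;> linarith [Real.neg_pi_div_two_lt_arctan ((m + 1 : ℝ) * f x),
            Real.arctan_lt_pi_div_two ((m + 1 : ℝ) * f x), Real.pi_lt_four]
        nlinarith [(Nat.cast_nonneg m : (0 : ℝ) ≤ m)]
      · refine ae_of_all _ fun x => ?_
        have h1 : Tendsto (fun m : ℕ => Real.arctan ((m + 1 : ℝ) * f x) / (m + 1)) atTop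
            (𝓝 0) := by
          refine squeeze_zero_norm (a := fun m : ℕ => 2 * (1 / ((m : ℝ) + 1))) (fun m => ?_) ?_
          · rw [Real.norm_eq_abs, abs_div, abs_of_pos (by positivity : (0 : ℝ) < m + 1),
              mul_one_div]
            gcongr
            rw [abs_le]
            constructor <;> linarith [Real.neg_pi_div_two_lt_arctan ((m + 1 : ℝ) * f x),
              Real.arctan_lt_pi_div_two ((m + 1 : ℝ) * f x), Real.pi_lt_four]
          · simpa using tendsto_one_div_add_atTop_nhds_zero_nat.const_mul (2 : ℝ)
        simpa using h1.mul_const (cpderiv i φ x)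
    have l2 : Tendsto (fun m : ℕ => ∫ x in Ω,
        1 / (1 + ((m + 1 : ℝ) * f x) ^ 2) * g x * φ x) atTop (𝓝 (∫ x in Ω, q x * φ x)) := by
      refine tendsto_integral_of_dominated_convergence (fun x => |g x| * C) ?_ ?_ ?_ ?_
      · intro m
        refine AEStronglyMeasurable.mul (AEStronglyMeasurable.mul ?_ hg.1)
          hφ.continuous.aestronglyMeasurable
        refine Continuous.comp_aestronglyMeasurable
          (g := fun t : ℝ => 1 / (1 + ((m + 1 : ℝ) * t) ^ 2)) ?_ hf.1
        exact continuous_const.div (by fun_prop) fun t => by positivity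
      · exact hgi.abs.mul_const C
      · refine fun m => ae_of_all _ fun x => ?_
        rw [norm_mul, norm_mul]
        refine mul_le_mul ?_ (hC x) (norm_nonneg _) (abs_nonneg _)
        exact mul_le_of_le_one_left (abs_nonneg _) (hF' m _)
      · refine ae_of_all _ fun x => ?_
        refine Tendsto.mul_const _ (Tendsto.mul_const _ ?_)
        by_cases hx : f x = 0
        · simp [hx]
        · simp only [hx, if_false]
          refine squeeze_zero_norm (a := fun m : ℕ => (1 / (f x) ^ 2) * (1 / ((m : ℝ) + 1)))
            (fun m => ?_) ?_
          · have h2 : 0 < (f x) ^ 2 := by positivity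
            rw [Real.norm_eq_abs, abs_of_nonneg (by positivity), one_div_mul_one_div]
            refine one_div_le_one_div_of_le (by positivity) ?_
            have h3 : (0 : ℝ) ≤ m := Nat.cast_nonneg m
            nlinarith [mul_nonneg h3 h2.le, mul_nonneg (mul_nonneg h3 h3) h2.le]
          · have := tendsto_one_div_add_atTop_nhds_zero_nat.const_mul (1 / (f x) ^ 2)
            rwa [mul_zero] at this
    have l3 := l1.congr fun m => h _ _ _ (hF m) (hF' m) (hL m) φ hφ
    have := tendsto_nhds_unique l3 l2.neg
    simpa using this.symm
  filter_upwards [hq0] with x hx h0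
  simpa [hq, h0] using hx

end HasChainRule

/-! ### The half-space profile -/

/-- The one-dimensional profile `½ t² 𝟙_{t>0}`. -/
def halfSq (t : ℝ) : ℝ := if 0 < t then t ^ 2 / 2 else 0

/-- The `j`-th coordinate of the `i`-th standard basis vector. -/
def kron (i j : Fin n) : ℝ := (EuclideanSpace.single i (1 : ℝ) : RH n) j

lemma kron_sum_sq (j : Fin n) : ∑ i, kron i j * kron i j = 1 := by
  simp [kron]

lemma hasDerivAt_halfSq (t : ℝ) : HasDerivAt halfSq (max t 0) t := by
  rcases lt_trichotomy t 0 with h | h | h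
  · rw [max_eq_right h.le]
    refine (hasDerivAt_const t (0 : ℝ)).congr_of_eventuallyEq ?_
    filter_upwards [Iio_mem_nhds h] with s hs
    simp [halfSq, not_lt.2 (le_of_lt (mem_Iio.1 hs))]
  · subst h
    rw [max_self, hasDerivAt_iff_isLittleO]
    have h1 : (fun s : ℝ => s ^ 2) =o[𝓝 0] fun s => s := by
      simpa using Asymptotics.isLittleO_pow_pow (𝕜 := ℝ) (m := 1) (n := 2) (by norm_num)
    simp only [sub_zero, smul_zero]
    refine Asymptotics.IsBigO.trans_isLittleO ?_ h1
    refine Asymptotics.isBigO_of_le _ fun s => ?_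
    have h2 : |s ^ 2| = s ^ 2 := abs_of_nonneg (sq_nonneg s)
    by_cases hs : 0 < s
    · simp only [halfSq, hs, if_true, lt_irrefl, if_false, sub_zero, Real.norm_eq_abs, h2]
      rw [abs_of_nonneg (by positivity)]
      nlinarith [sq_nonneg s]
    · simp [halfSq, hs, sq_nonneg]
  · rw [max_eq_left h.le]
    have h1 : HasDerivAt (fun s : ℝ => s ^ 2 / 2) t t := by
      have := (hasDerivAt_pow 2 t).div_const 2
      simpa using this
    refine h1.congr_of_eventuallyEq ?_
    filter_upwards [Ioi_mem_nhds h] with s hs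
    simp [halfSq, mem_Ioi.1 hs]

lemma hasDerivAt_max_zero {t : ℝ} (ht : t ≠ 0) :
    HasDerivAt (fun s : ℝ => max s 0) (if 0 < t then 1 else 0) t := by
  rcases lt_or_gt_of_ne ht with h | h
  · rw [if_neg (not_lt.2 h.le)]
    refine (hasDerivAt_const t (0 : ℝ)).congr_of_eventuallyEq ?_
    filter_upwards [Iio_mem_nhds h] with s hs
    exact max_eq_right (le_of_lt hs)
  · rw [if_pos h]
    refine (hasDerivAt_id t).congr_of_eventuallyEq ?_
    filter_upwards [Ioi_mem_nhds h] with s hs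
    exact max_eq_left (le_of_lt hs)

lemma continuous_halfSq : Continuous halfSq :=
  continuous_iff_continuousAt.2 fun t => (hasDerivAt_halfSq t).continuousAt

lemma continuous_coord (j : Fin n) : Continuous fun x : RH n => x j := by fun_prop

lemma hasLineDerivAt_coord (i j : Fin n) (x : RH n) :
    HasLineDerivAt ℝ (fun y : RH n => y j) (kron i j) x (EuclideanSpace.single i 1) :=
  (EuclideanSpace.proj (𝕜 := ℝ) j).hasFDerivAt.hasLineDerivAt _

lemma ae_coord_ne_zero (j : Fin n) : ∀ᵐ x : RH n, x j ≠ 0 := by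
  have h := Measure.addHaar_submodule (volume : Measure (RH n))
    (LinearMap.ker (EuclideanSpace.proj (𝕜 := ℝ) j : RH n →L[ℝ] ℝ).toLinearMap) (by
      intro htop
      have : (EuclideanSpace.single j (1 : ℝ) : RH n) ∈
          LinearMap.ker (EuclideanSpace.proj (𝕜 := ℝ) j : RH n →L[ℝ] ℝ).toLinearMap := by
        rw [htop]
        trivial
      simp at this)
  rw [ae_iff]
  refine measure_mono_null (fun x hx => ?_) h
  simpa using hx

lemma HasLineDerivAt.add_real {f g : RH n → ℝ} {a b : ℝ} {x v : RH n}
    (hf : HasLineDerivAt ℝ f a x v) (hg : HasLineDerivAt ℝ g b x v) :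
    HasLineDerivAt ℝ (fun y => f y + g y) (a + b) x v :=
  HasDerivAt.add (f := fun t : ℝ => f (x + t • v)) hf hg

lemma memLp_of_continuous {Ω : Set (RH n)} (hΩ : Bornology.IsBounded Ω) (hm : MeasurableSet Ω)
    [IsFiniteMeasure (volume.restrict Ω)] {f : RH n → ℝ} (hf : Continuous f) {p : ℝ≥0∞} :
    MemLp f p (volume.restrict Ω) := by
  obtain ⟨C, hC⟩ := hΩ.isCompact_closure.exists_bound_of_continuousOn hf.continuousOn
  refine MemLp.of_bound hf.aestronglyMeasurable C ?_
  filter_upwards [ae_restrict_mem hm] with x hx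
  exact hC x (subset_closure hx)

lemma measurable_step (j : Fin n) : Measurable fun x : RH n => if 0 < x j then (1 : ℝ) else 0 :=
  Measurable.ite (measurableSet_lt measurable_const (continuous_coord j).measurable)
    measurable_const measurable_const

lemma memLp_step (j : Fin n) (Ω : Set (RH n)) [IsFiniteMeasure (volume.restrict Ω)]
    {p : ℝ≥0∞} : MemLp (fun x : RH n => if 0 < x j then (1 : ℝ) else 0) p (volume.restrict Ω) := by
  refine MemLp.of_bound (measurable_step j).aestronglyMeasurable 1 (ae_of_all _ fun x => ?_)
  split_ifs <;> simp

/-! ### Perturbations in `H₀²` -/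

/-- Test functions `φ k` approximating `w` in `H²(Ω)`, with gradient `g` and pure second
derivatives `h`. -/
structure H20Approx (Ω : Set (RH n)) (w : RH n → ℝ) (g h : Fin n → RH n → ℝ)
    (φ : ℕ → RH n → ℝ) : Prop where
  test : ∀ k, IsTestFun Ω (φ k)
  tendsto : L2Tendsto (volume.restrict Ω) φ w
  tendsto_grad : ∀ i, L2Tendsto (volume.restrict Ω) (fun k => cpderiv i (φ k)) (g i)
  tendsto_hess : ∀ i,
    L2Tendsto (volume.restrict Ω) (fun k => cpderiv i (cpderiv i (φ k))) (h i)

lemma MemH20.exists_approx {Ω : Set (RH n)} {w : RH n → ℝ} (hw : MemH20 Ω w) :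
    ∃ g h φ, H20Approx Ω w g h φ := by
  obtain ⟨g, h, ⟨h1, h2, h3⟩, φ, hφ, l1, l2, l3⟩ := hw
  exact ⟨g, fun i => h i i, φ, hφ, ⟨h1, fun k => (hφ k).memLp, l1⟩,
    fun i => ⟨(h2 i).2, fun k => ((hφ k).cpderiv i).memLp, l2 i⟩,
    fun i => ⟨(h3 i i).2, fun k => (((hφ k).cpderiv i).cpderiv i).memLp, l3 i i⟩⟩

namespace H20Approx

variable {Ω : Set (RH n)} {w : RH n → ℝ} {g h : Fin n → RH n → ℝ} {φ : ℕ → RH n → ℝ}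

lemma zero : H20Approx Ω (fun _ => 0) (fun _ _ => 0) (fun _ _ => 0) (fun _ _ => 0) := by
  have h1 : ∀ i : Fin n, cpderiv i (fun _ : RH n => (0 : ℝ)) = fun _ => 0 := by
    intro i
    funext x
    simp [cpderiv]
  have h2 : L2Tendsto (volume.restrict Ω) (fun _ (_ : RH n) => (0 : ℝ)) (fun _ => 0) :=
    L2Tendsto.const MemLp.zero'
  exact ⟨fun _ => IsTestFun.zero, h2, fun i => by simpa only [h1] using h2,
    fun i => by simpa only [h1] using h2⟩

lemma hasChainRule (H : H20Approx Ω w g h φ) (hb : Bornology.IsBounded Ω) (hm : MeasurableSet Ω)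
    [IsFiniteMeasure (volume.restrict Ω)] (i j : Fin n) :
    HasChainRule Ω i (fun x => halfSq (x j) + w x) (fun x => max (x j) 0 * kron i j + g i x) := by
  refine HasChainRule.of_tendsto (fun k => ?_)
    ((L2Tendsto.const (memLp_of_continuous hb hm
      (continuous_halfSq.comp (continuous_coord j)))).add H.tendsto)
    ((L2Tendsto.const (memLp_of_continuous hb hm
      (f := fun x : RH n => max (x j) 0 * kron i j) (by fun_prop))).add (H.tendsto_grad i))
  refine HasChainRule.of_hasLineDerivAt
    ((continuous_halfSq.comp (continuous_coord j)).add (H.test k).continuous)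
    (Continuous.add (by fun_prop) ((H.test k).cpderiv i).continuous) fun x => ?_
  exact (HasLineDerivAt.scomp_real (hasDerivAt_halfSq _) (hasLineDerivAt_coord i j x)).add_real
    ((H.test k).hasLineDerivAt i x)

lemma hasChainRule_grad (H : H20Approx Ω w g h φ) (hb : Bornology.IsBounded Ω)
    (hm : MeasurableSet Ω) [IsFiniteMeasure (volume.restrict Ω)] (i j : Fin n) :
    HasChainRule Ω i (fun x => max (x j) 0 * kron i j + g i x)
      (fun x => (if 0 < x j then 1 else 0) * (kron i j * kron i j) + h i x) := by
  have hstep : MemLp (fun x : RH n => (if 0 < x j then (1 : ℝ) else 0) * (kron i j * kron i j)) 2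
      (volume.restrict Ω) := (memLp_step j Ω).mul_const _
  refine HasChainRule.of_tendsto (fun k => ?_)
    ((L2Tendsto.const (memLp_of_continuous hb hm
      (f := fun x : RH n => max (x j) 0 * kron i j) (by fun_prop))).add (H.tendsto_grad i))
    ((L2Tendsto.const hstep).add (H.tendsto_hess i))
  obtain ⟨D, hD⟩ := ContDiff.lipschitzWith_of_hasCompactSupport ((H.test k).cpderiv i).2.1
    ((H.test k).cpderiv i).1 (by simp)
  have h1 : LipschitzWith (Real.toNNReal |kron i j|) (fun x : RH n => max (x j) 0 * kron i j) := by
    refine LipschitzWith.of_dist_le' fun x y => ?_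
    rw [Real.dist_eq, ← sub_mul, abs_mul, mul_comm]
    refine mul_le_mul_of_nonneg_left ?_ (abs_nonneg _)
    refine (abs_max_sub_max_le_abs _ _ _).trans ?_
    rw [dist_eq_norm]
    exact PiLp.norm_apply_le (x - y) j
  refine HasChainRule.of_lipschitz (h1.add hD) ?_
  filter_upwards [ae_coord_ne_zero j] with x hx
  have h2 := HasLineDerivAt.scomp_real (hasDerivAt_max_zero hx) (hasLineDerivAt_coord i j x)
  have h3 := HasLineDerivAt.scomp_real (hasDerivAt_mul_const (x := max (x j) 0) (kron i j)) h2
  refine HasLineDerivAt.add_real ?_ (((H.test k).cpderiv i).hasLineDerivAt i x)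
  have e : (if 0 < x j then (1 : ℝ) else 0) * (kron i j * kron i j)
      = kron i j * ((if 0 < x j then (1 : ℝ) else 0) * kron i j) := by ring
  rw [e]
  exact h3

/-- The Laplacians of the test functions converge to that of `w`. -/
lemma tendsto_lap (H : H20Approx Ω w g h φ) :
    L2Tendsto (volume.restrict Ω) (fun k => cLaplacian (φ k)) (fun x => ∑ i, h i x) :=
  L2Tendsto.sum Finset.univ fun i => H.tendsto_hess i

/-- The Laplacian of an `H₀²` function is orthogonal to affine functions. -/
lemma integral_lap_mul (H : H20Approx Ω w g h φ) (hb : Bornology.IsBounded Ω)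
    (hm : MeasurableSet Ω) [IsFiniteMeasure (volume.restrict Ω)] {p : RH n → ℝ}
    (hp : Continuous p) {c : Fin n → ℝ}
    (hpc : ∀ i x, HasLineDerivAt ℝ p (c i) x (EuclideanSpace.single i 1)) :
    ∫ x in Ω, (∑ i, h i x) * p x = 0 := by
  have h1 := H.tendsto_lap.integral_mul (L2Tendsto.const (memLp_of_continuous hb hm hp))
  refine tendsto_nhds_unique h1 (tendsto_const_nhds.congr fun k => ?_)
  have h0 : ∀ i, ∫ x in Ω, p x * cpderiv i (cpderiv i (φ k)) x = 0 := by
    intro i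
    rw [((H.test k).cpderiv i).integral_mul_cpderiv hp continuous_const (hpc i),
      (H.test k).integral_mul_cpderiv continuous_const continuous_const (g := fun _ => 0)
        (fun x => hasDerivAt_const (0 : ℝ) (c i))]
    simp
  simp only [cLaplacian, Finset.sum_mul]
  rw [integral_finsetSum]
  · refine (Finset.sum_eq_zero fun i _ => ?_).symm
    rw [← h0 i]
    simp only [mul_comm]
  · intro i _
    simpa only [mul_comm] using ((((H.test k).cpderiv i).cpderiv i).integrable_mul hp).restrict

/-- An `H₀²` function with vanishing Laplacian vanishes. -/
lemma ae_eq_zero_of_lap (H : H20Approx Ω w g h φ) (hb : Bornology.IsBounded Ω)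
    (hm : MeasurableSet Ω) [IsFiniteMeasure (volume.restrict Ω)] (j : Fin n)
    (hlap : ∀ᵐ x ∂volume.restrict Ω, ∑ i, h i x = 0) :
    ∀ᵐ x ∂volume.restrict Ω, w x = 0 := by
  have hgj : ∀ᵐ x ∂volume.restrict Ω, g j x = 0 := by
    have l1 := (H.tendsto_grad j).integral_mul (H.tendsto_grad j)
    have l2 := (H.tendsto_lap.integral_mul H.tendsto).neg
    have e : ∫ x in Ω, (∑ i, h i x) * w x = 0 := by
      rw [← integral_zero (RH n) ℝ (μ := volume.restrict Ω)]
      refine integral_congr_ae ?_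
      filter_upwards [hlap] with x hx
      rw [hx, zero_mul]
    have hle := le_of_tendsto_of_tendsto' l1 l2 fun k => by
      have e1 : ∫ x in Ω, cLaplacian (φ k) x * φ k x
          = - ∑ i, ∫ x in Ω, cpderiv i (φ k) x * cpderiv i (φ k) x := by
        simp only [cLaplacian, Finset.sum_mul]
        rw [integral_finsetSum, ← Finset.sum_neg_distrib]
        · refine Finset.sum_congr rfl fun i _ => ?_
          rw [(H.test k).integral_mul_cpderiv ((H.test k).cpderiv i).continuous
            (((H.test k).cpderiv i).cpderiv i).continuous
            (((H.test k).cpderiv i).hasLineDerivAt i), neg_neg]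
        · exact fun i _ =>
            ((H.test k).integrable_mul (((H.test k).cpderiv i).cpderiv i).continuous).restrict
      rw [e1, neg_neg]
      exact Finset.single_le_sum
        (f := fun i => ∫ x in Ω, cpderiv i (φ k) x * cpderiv i (φ k) x)
        (fun i _ => integral_nonneg fun x => mul_self_nonneg _) (Finset.mem_univ j)
    rw [e, neg_zero] at hle
    have h0 : ∫ x in Ω, g j x * g j x = 0 :=
      le_antisymm hle (integral_nonneg fun x => mul_self_nonneg _)
    rw [integral_eq_zero_iff_of_nonneg (fun x => mul_self_nonneg _)
      ((H.tendsto_grad j).memLp_lim.integrable_mul (H.tendsto_grad j).memLp_lim)] at h0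
    filter_upwards [h0] with x hx
    exact mul_self_eq_zero.1 hx
  obtain ⟨C, hC⟩ := hb.exists_norm_le
  have hcoord : L2Tendsto (volume.restrict Ω)
      (fun k x => cpderiv j (φ k) x * x j) (fun x => g j x * x j) := by
    have hp : Measurable fun x : RH n => Ω.indicator (fun y : RH n => y j) x :=
      (continuous_coord j).measurable.indicator hm
    have := (H.tendsto_grad j).mul_bounded (C := max C 0) hp.aestronglyMeasurable fun x => by
      by_cases hx : x ∈ Ω
      · rw [indicator_of_mem hx]
        exact ((PiLp.norm_apply_le x j).trans (hC x hx)).trans (le_max_left _ _)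
      · rw [indicator_of_notMem hx, abs_zero]
        exact le_max_right _ _
    have e : ∀ q : RH n → ℝ, (fun x => q x * Ω.indicator (fun y : RH n => y j) x)
        =ᵐ[volume.restrict Ω] fun x => q x * x j := fun q => by
      filter_upwards [ae_restrict_mem hm] with x hx
      rw [indicator_of_mem hx]
    refine ⟨this.memLp_lim.ae_eq (e _), fun k => (this.memLp k).ae_eq (e _), ?_⟩
    refine this.tendsto.congr fun k => eLpNorm_congr_ae ?_
    exact (e _).sub (e _)
  have l1 := H.tendsto.integral_mul H.tendsto
  have l2 := (hcoord.integral_mul H.tendsto).const_mul (-2)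
  have e : ∫ x in Ω, g j x * x j * w x = 0 := by
    rw [← integral_zero (RH n) ℝ (μ := volume.restrict Ω)]
    refine integral_congr_ae ?_
    filter_upwards [hgj] with x hx
    rw [hx, zero_mul, zero_mul]
  rw [e, mul_zero] at l2
  have h0 : ∫ x in Ω, w x * w x = 0 := by
    refine tendsto_nhds_unique l1 (l2.congr fun k => ?_)
    have hT := H.test k
    have hc := (hT.cpderiv j).continuous
    have h1 := hT.integral_mul_cpderiv (i := j) (f := fun x => x j * φ k x)
      (g := fun x => kron j j * φ k x + x j * cpderiv j (φ k) x)
      ((continuous_coord j).mul hT.continuous)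
      ((continuous_const.mul hT.continuous).add ((continuous_coord j).mul hc))
      (fun x => by
        have := HasDerivAt.mul (hasLineDerivAt_coord j j x) (hT.hasLineDerivAt j x)
        simp only [zero_smul, add_zero] at this
        exact this)
    have hk : kron j j = 1 := by simp [kron]
    simp only [hk, one_mul, add_mul] at h1
    rw [integral_add (hT.integrable_mul hT.continuous).restrict
      (hT.integrable_mul (f := fun x => x j * cpderiv j (φ k) x)
        ((continuous_coord j).mul hc)).restrict] at h1
    have h2 : ∫ x in Ω, x j * φ k x * cpderiv j (φ k) x
        = ∫ x in Ω, cpderiv j (φ k) x * x j * φ k x :=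
      integral_congr_ae (ae_of_all _ fun x => by ring)
    have h3 : ∫ x in Ω, x j * cpderiv j (φ k) x * φ k x
        = ∫ x in Ω, cpderiv j (φ k) x * x j * φ k x :=
      integral_congr_ae (ae_of_all _ fun x => by ring)
    rw [h2, h3] at h1
    linarith
  rw [integral_eq_zero_iff_of_nonneg (fun x => mul_self_nonneg _)
    (H.tendsto.memLp_lim.integrable_mul H.tendsto.memLp_lim)] at h0
  filter_upwards [h0] with x hx
  exact mul_self_eq_zero.1 hx

end H20Approx

/-! ### Weak Laplacians and minimality -/

/-- A weak Laplacian, even if not assumed locally integrable, agrees with an integrable one as soon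
as the latter has nonzero mean. -/
lemma IsWeakLaplacian.ae_eq {Ω : Set (RH n)} (hΩ : IsOpen Ω) {v f G : RH n → ℝ}
    (hf : IsWeakLaplacian Ω v f) (hG : IsWeakLaplacian Ω v G)
    (hGi : IntegrableOn G Ω) (hG0 : ∫ x in Ω, G x ≠ 0) :
    ∀ᵐ x ∂volume.restrict Ω, f x = G x := by
  have hGφ : ∀ φ, IsTestFun Ω φ → IntegrableOn (fun x => G x * φ x) Ω := fun φ hφ => by
    obtain ⟨C, hC⟩ := hφ.exists_bound
    exact Integrable.mul_bdd hGi hφ.continuous.aestronglyMeasurable (ae_of_all _ hC)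
  have hfφ : ∀ φ, IsTestFun Ω φ → IntegrableOn (fun x => f x * φ x) Ω := by
    by_contra! hcon
    obtain ⟨φ₀, h₀, hn₀⟩ := hcon
    have key : ∀ φ, IsTestFun Ω φ → ¬ IntegrableOn (fun x => f x * φ x) Ω →
        ∫ x in Ω, G x * φ x = 0 := fun φ hφ hni => by
      rw [← hG φ hφ, hf φ hφ, integral_undef hni]
    have hz := ae_eq_zero_of_forall_test hΩ hGi.locallyIntegrableOn fun φ hφ => by
      by_cases hi : IntegrableOn (fun x => f x * φ x) Ω
      · have h1 := key _ (hφ.add h₀) fun hi' => hn₀ <| by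
          refine (Integrable.sub hi' hi).congr (ae_of_all _ fun x => ?_)
          simp only [Pi.sub_apply]
          ring
        simp only [mul_add] at h1
        rw [integral_add (hGφ φ hφ) (hGφ φ₀ h₀), key φ₀ h₀ hn₀, add_zero] at h1
        exact h1
      · exact key φ hφ hi
    exact hG0 (integral_eq_zero_of_ae hz)
  have hloc : LocallyIntegrableOn f Ω := by
    intro x hx
    obtain ⟨ε, hε, hball⟩ := Metric.isOpen_iff.1 hΩ x hx
    let b : ContDiffBump x := ⟨ε / 4, ε / 2, by positivity, by linarith⟩
    have hb : IsTestFun Ω b := ⟨b.contDiff, b.hasCompactSupport, by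
      rw [b.tsupport_eq]
      exact (closedBall_subset_ball (by change ε / 2 < ε; linarith)).trans hball⟩
    refine ⟨ball x (ε / 4), mem_nhdsWithin_of_mem_nhds (ball_mem_nhds x (by positivity)), ?_⟩
    have hs : ball x (ε / 4) ⊆ Ω := (ball_subset_ball (by linarith)).trans hball
    refine ((hfφ b hb).mono_set hs).congr_fun (fun y hy => ?_) measurableSet_ball
    have : b y = 1 := b.one_of_mem_closedBall (ball_subset_closedBall hy)
    simp [this]
  have hsub := ae_eq_zero_of_forall_test (f := fun x => f x - G x) hΩ
    (hloc.sub hGi.locallyIntegrableOn) fun φ hφ => by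
      simp only [sub_mul]
      rw [integral_sub (hfφ φ hφ) (hGφ φ hφ), ← hf φ hφ, hG φ hφ, sub_self]
  filter_upwards [hsub] with x hx
  exact sub_eq_zero.1 hx

lemma volume_ne_zero_eq_integral {Ω : Set (RH n)} (hm : MeasurableSet Ω) {f : RH n → ℝ}
    (hf : AEMeasurable f (volume.restrict Ω)) :
    (volume {x ∈ Ω | f x ≠ 0}).toReal = ∫ x in Ω, if f x ≠ 0 then (1 : ℝ) else 0 := by
  have hs : NullMeasurableSet {x | f x ≠ 0} (volume.restrict Ω) :=
    hf.nullMeasurable (measurableSet_singleton (0 : ℝ)).compl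
  have h1 : (fun x => if f x ≠ 0 then (1 : ℝ) else 0)
      = {x | f x ≠ 0}.indicator fun _ => (1 : ℝ) := by
    funext x
    simp [indicator_apply]
  rw [h1, integral_indicator₀ hs, setIntegral_const, smul_eq_mul, mul_one, Measure.real,
    Measure.restrict_apply' hm]
  congr 2
  ext x
  simp [and_comm]

lemma halfSq_ne_zero {t : ℝ} : halfSq t ≠ 0 ↔ 0 < t := by
  unfold halfSq
  split_ifs with h
  · simp [h, h.ne']
  · simp [h]

lemma integral_step_pos {R : ℝ} (hR : 0 < R) (j : Fin n) :
    0 < ∫ x in ball (0 : RH n) R, if 0 < x j then (1 : ℝ) else 0 := by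
  have : IsFiniteMeasure (volume.restrict (ball (0 : RH n) R)) :=
    ⟨by simpa using measure_ball_lt_top⟩
  have hpos : IsOpen {x : RH n | 0 < x j} := isOpen_lt continuous_const (continuous_coord j)
  rw [integral_pos_iff_support_of_nonneg (fun x => by positivity)
    ((memLp_step j _).integrable le_rfl), Measure.restrict_apply' measurableSet_ball]
  have hs : Function.support (fun x : RH n => if 0 < x j then (1 : ℝ) else 0)
      = {x | 0 < x j} := by
    ext x
    simp
  rw [hs]
  refine (hpos.inter isOpen_ball).measure_pos volume
    ⟨EuclideanSpace.single j (R / 2), ?_, ?_⟩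
  · simpa using hR
  · rw [mem_ball_zero_iff, PiLp.norm_single, Real.norm_eq_abs,
      abs_of_pos (by positivity)]
    linarith

namespace H20Approx

variable {Ω : Set (RH n)} {w : RH n → ℝ} {g h : Fin n → RH n → ℝ} {φ : ℕ → RH n → ℝ}

lemma isWeakLaplacian (H : H20Approx Ω w g h φ) (hb : Bornology.IsBounded Ω)
    (hm : MeasurableSet Ω) [IsFiniteMeasure (volume.restrict Ω)] (j : Fin n) :
    IsWeakLaplacian Ω (fun x => halfSq (x j) + w x)
      (fun x => (if 0 < x j then 1 else 0) + ∑ i, h i x) := by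
  intro ψ hψ
  have hv : MemLp (fun x => halfSq (x j) + w x) 2 (volume.restrict Ω) :=
    (memLp_of_continuous hb hm (continuous_halfSq.comp (continuous_coord j))).add
      H.tendsto.memLp_lim
  have hh : ∀ i, MemLp (fun x => (if 0 < x j then 1 else 0) * (kron i j * kron i j) + h i x) 2
      (volume.restrict Ω) := fun i =>
    MemLp.add (f := fun x : RH n => (if 0 < x j then 1 else 0) * (kron i j * kron i j))
      ((memLp_step j Ω).mul_const _) (H.tendsto_hess i).memLp_lim
  have h1 : ∀ i, ∫ x in Ω, (halfSq (x j) + w x) * cpderiv i (cpderiv i ψ) x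
      = ∫ x in Ω, ((if 0 < x j then 1 else 0) * (kron i j * kron i j) + h i x) * ψ x := by
    intro i
    rw [(H.hasChainRule hb hm i j).integral_mul_cpderiv (hψ.cpderiv i),
      (H.hasChainRule_grad hb hm i j).integral_mul_cpderiv hψ, neg_neg]
  have h2 : ∀ x, (if 0 < x j then 1 else 0) + ∑ i, h i x
      = ∑ i, ((if 0 < x j then 1 else 0) * (kron i j * kron i j) + h i x) := fun x => by
    rw [Finset.sum_add_distrib, ← Finset.mul_sum, kron_sum_sq, mul_one]
  simp only [h2, cLaplacian, Finset.mul_sum, Finset.sum_mul]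
  rw [integral_finsetSum, integral_finsetSum]
  · exact Finset.sum_congr rfl fun i _ => h1 i
  · exact fun i _ => (hh i).integrable_mul (hψ.memLp (p := 2))
  · exact fun i _ => hv.integrable_mul (((hψ.cpderiv i).cpderiv i).memLp (p := 2))

/-- The Laplacian of the perturbed half-space function vanishes on its zero set. -/
lemma ae_lap_eq_zero (H : H20Approx Ω w g h φ) (hb : Bornology.IsBounded Ω) (hΩ : IsOpen Ω)
    [IsFiniteMeasure (volume.restrict Ω)] (j : Fin n) :
    ∀ᵐ x ∂volume.restrict Ω, halfSq (x j) + w x = 0 →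
      (if 0 < x j then 1 else 0) + ∑ i, h i x = 0 := by
  have hm := hΩ.measurableSet
  have hv : MemLp (fun x => halfSq (x j) + w x) 2 (volume.restrict Ω) :=
    (memLp_of_continuous hb hm (continuous_halfSq.comp (continuous_coord j))).add
      H.tendsto.memLp_lim
  have hg : ∀ i, MemLp (fun x => max (x j) 0 * kron i j + g i x) 2 (volume.restrict Ω) := fun i =>
    (memLp_of_continuous hb hm (f := fun x : RH n => max (x j) 0 * kron i j) (by fun_prop)).add
      (H.tendsto_grad i).memLp_lim
  have hh : ∀ i, MemLp (fun x => (if 0 < x j then 1 else 0) * (kron i j * kron i j) + h i x) 2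
      (volume.restrict Ω) := fun i =>
    MemLp.add (f := fun x : RH n => (if 0 < x j then 1 else 0) * (kron i j * kron i j))
      ((memLp_step j Ω).mul_const _) (H.tendsto_hess i).memLp_lim
  have h1 := ae_all_iff.2 fun i => (H.hasChainRule hb hm i j).ae_eq_zero hΩ hv (hg i)
  have h2 := ae_all_iff.2 fun i => (H.hasChainRule_grad hb hm i j).ae_eq_zero hΩ (hg i) (hh i)
  filter_upwards [h1, h2] with x hx1 hx2 hx
  have h3 : (if 0 < x j then 1 else 0) + ∑ i, h i x
      = ∑ i, ((if 0 < x j then 1 else 0) * (kron i j * kron i j) + h i x) := by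
    rw [Finset.sum_add_distrib, ← Finset.mul_sum, kron_sum_sq, mul_one]
  rw [h3]
  exact Finset.sum_eq_zero fun i _ => hx2 i (hx1 i hx)

/-- The mean of the Laplacian of the perturbed half-space function does not depend on the
perturbation. -/
lemma integral_lap (H : H20Approx Ω w g h φ) (hb : Bornology.IsBounded Ω)
    (hm : MeasurableSet Ω) [IsFiniteMeasure (volume.restrict Ω)] (j : Fin n) :
    ∫ x in Ω, ((if 0 < x j then 1 else 0) + ∑ i, h i x)
      = ∫ x in Ω, if 0 < x j then (1 : ℝ) else 0 := by
  have h1 := H.integral_lap_mul hb hm (p := fun _ => 1) continuous_const (c := fun _ => 0)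
    fun i x => hasDerivAt_const (0 : ℝ) (1 : ℝ)
  simp only [mul_one] at h1
  rw [integral_add ((memLp_step j Ω).integrable le_rfl)
    (H.tendsto_lap.memLp_lim.integrable (by norm_num)), h1, add_zero]

/-- Any weak Laplacian of the perturbed half-space function is `𝟙_{x_j > 0} + Δw`. -/
lemma ae_eq_of_isWeakLaplacian {R : ℝ} (H : H20Approx (ball 0 R) w g h φ) (hR : 0 < R)
    (j : Fin n) {f : RH n → ℝ}
    (hf : IsWeakLaplacian (ball 0 R) (fun x => halfSq (x j) + w x) f) :
    ∀ᵐ x ∂volume.restrict (ball (0 : RH n) R),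
      f x = (if 0 < x j then 1 else 0) + ∑ i, h i x := by
  have : IsFiniteMeasure (volume.restrict (ball (0 : RH n) R)) :=
    ⟨by simpa using measure_ball_lt_top⟩
  refine hf.ae_eq isOpen_ball (H.isWeakLaplacian isBounded_ball measurableSet_ball j) ?_ ?_
  · exact (MemLp.add (memLp_step j _) H.tendsto_lap.memLp_lim).integrable (by norm_num)
  · rw [H.integral_lap isBounded_ball measurableSet_ball j]
    exact ne_of_gt (integral_step_pos hR j)

/-- Minimality of the half-space function among its `H₀²` perturbations on a ball. -/
lemma le_acf {R : ℝ} (H : H20Approx (ball 0 R) w g h φ) (hR : 0 < R) (j : Fin n)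
    (f : RH n → ℝ) (hf : IsWeakLaplacian (ball 0 R) (fun x => halfSq (x j) + w x) f) :
    ACF (ball (0 : RH n) R) (fun x => if 0 < x j then 1 else 0) (fun x => halfSq (x j))
      ≤ ACF (ball (0 : RH n) R) f (fun x => halfSq (x j) + w x) ∧
    (ACF (ball (0 : RH n) R) (fun x => if 0 < x j then 1 else 0) (fun x => halfSq (x j))
      = ACF (ball (0 : RH n) R) f (fun x => halfSq (x j) + w x) ↔
      ∀ᵐ (x : RH n) ∂volume.restrict (ball (0 : RH n) R), w x = 0) := by
  have hfin : IsFiniteMeasure (volume.restrict (ball (0 : RH n) R)) :=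
    ⟨by simpa using measure_ball_lt_top⟩
  have hfG := H.ae_eq_of_isWeakLaplacian hR j hf
  have hG0 := H.ae_lap_eq_zero isBounded_ball isOpen_ball j
  have hGint := H.integral_lap isBounded_ball measurableSet_ball j
  set μ := volume.restrict (ball (0 : RH n) R) with hμ
  set G : RH n → ℝ := fun x => (if 0 < x j then 1 else 0) + ∑ i, h i x with hG
  set V : RH n → ℝ := fun x => halfSq (x j) + w x with hV
  set e : RH n → ℝ := fun x => if V x ≠ 0 then 1 else 0 with he
  set m : ℝ := ∫ x, (if 0 < x j then (1 : ℝ) else 0) ∂μ with hmdef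
  have hGm : MemLp G 2 μ := (memLp_step j _).add H.tendsto_lap.memLp_lim
  have hVm : AEMeasurable V μ :=
    ((continuous_halfSq.comp (continuous_coord j)).aestronglyMeasurable.add
      H.tendsto.memLp_lim.1).aemeasurable
  have hem : MemLp e 2 μ := by
    have h1 : AEMeasurable e μ :=
      (Measurable.ite (p := fun t : ℝ => t ≠ 0) (measurableSet_singleton 0).compl
        measurable_const measurable_const).comp_aemeasurable hVm
    refine MemLp.of_bound h1.aestronglyMeasurable 1 (ae_of_all _ fun x => ?_)
    simp only [he]
    split_ifs <;> simp
  have hACFu : ACF (ball (0 : RH n) R) (fun x => if 0 < x j then 1 else 0)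
      (fun x => halfSq (x j)) = 2 * m := by
    rw [ACF, volume_ne_zero_eq_integral (f := fun x : RH n => halfSq (x j)) measurableSet_ball
      (continuous_halfSq.comp (continuous_coord j)).aemeasurable]
    simp only [halfSq_ne_zero, ite_pow, one_pow, ne_eq, OfNat.ofNat_ne_zero, not_false_eq_true,
      zero_pow]
    rw [two_mul]
  have hACFv : ACF (ball (0 : RH n) R) f V = (∫ x, G x ^ 2 ∂μ) + ∫ x, e x ∂μ := by
    rw [ACF, volume_ne_zero_eq_integral measurableSet_ball hVm]
    congr 1
    refine integral_congr_ae ?_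
    filter_upwards [hfG] with x hx
    rw [hx]
  have hsq : ∫ x, (G x - e x) ^ 2 ∂μ = (∫ x, G x ^ 2 ∂μ) + ∫ x, e x ∂μ - 2 * m := by
    have h1 : ∫ x, (G x - e x) ^ 2 ∂μ = ∫ x, (G x ^ 2 + e x - 2 * G x) ∂μ := by
      refine integral_congr_ae ?_
      filter_upwards [hG0] with x hx
      by_cases hVx : V x = 0
      · simp only [he, hVx, ne_eq, not_true_eq_false, if_false]
        rw [show G x = 0 from hx hVx]
        ring
      · simp only [he, hVx, ne_eq, not_false_eq_true, if_true]
        ring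
    have hGi : Integrable G μ := hGm.integrable (by norm_num)
    have hei : Integrable e μ := hem.integrable (by norm_num)
    rw [h1, integral_sub (f := fun x => G x ^ 2 + e x) (hGm.integrable_sq.add hei) (hGi.const_mul 2),
      integral_add hGm.integrable_sq hei, integral_const_mul, hGint]
  have hdiff : ACF (ball (0 : RH n) R) f V - ACF (ball (0 : RH n) R)
      (fun x => if 0 < x j then 1 else 0) (fun x => halfSq (x j)) = ∫ x, (G x - e x) ^ 2 ∂μ := by
    rw [hsq, hACFu, hACFv]
  refine ⟨?_, fun heq => ?_, fun hw => ?_⟩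
  · rw [← sub_nonneg, hdiff]
    exact integral_nonneg fun x => sq_nonneg _
  · rw [heq, sub_self] at hdiff
    have h0 := (integral_eq_zero_iff_of_nonneg (fun x => sq_nonneg (G x - e x))
      (hGm.sub hem).integrable_sq).1 hdiff.symm
    have hGe : ∀ᵐ x ∂μ, G x = e x := by
      filter_upwards [h0] with x hx
      exact sub_eq_zero.1 (pow_eq_zero_iff two_ne_zero |>.1 hx)
    have h1 := H.integral_lap_mul isBounded_ball measurableSet_ball (continuous_coord j)
      (c := fun i => kron i j) fun i x => hasLineDerivAt_coord i j x
    set q : RH n → ℝ := fun x => -((∑ i, h i x) * x j) with hq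
    have hqae : ∀ᵐ x ∂μ, q x = ((if 0 < x j then 1 else 0) - e x) * x j := by
      filter_upwards [hGe] with x hx
      rw [← hx]
      simp only [hq, hG]
      ring
    have hqnn : 0 ≤ᵐ[μ] q := by
      filter_upwards [hqae] with x hx
      rw [hx, Pi.zero_apply]
      simp only [he]
      split_ifs <;> simp <;> linarith
    have hqi : Integrable q μ := (H.tendsto_lap.memLp_lim.integrable_mul
      (memLp_of_continuous isBounded_ball measurableSet_ball (continuous_coord j) (p := 2))).neg
    have hq0 : ∫ x, q x ∂μ = 0 := by
      rw [hq, integral_neg, h1, neg_zero]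
    rw [integral_eq_zero_iff_of_nonneg_ae hqnn hqi] at hq0
    refine H.ae_eq_zero_of_lap isBounded_ball measurableSet_ball j ?_
    filter_upwards [hq0, ae_restrict_of_ae (ae_coord_ne_zero j)] with x hx hxj
    have h2 : (∑ i, h i x) * x j = 0 := neg_eq_zero.1 hx
    exact (mul_eq_zero.1 h2).resolve_right hxj
  · have hVu : ∀ᵐ x ∂μ, V x = halfSq (x j) + 0 := by
      filter_upwards [hw] with x hx
      simp only [hV, hx]
    have hf' : IsWeakLaplacian (ball (0 : RH n) R) (fun x => halfSq (x j) + 0) f := by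
      intro ψ hψ
      rw [← hf ψ hψ]
      refine integral_congr_ae ?_
      filter_upwards [hVu] with x hx
      rw [hx]
    have hfu := H20Approx.zero.ae_eq_of_isWeakLaplacian hR j hf'
    rw [hACFu, hACFv, two_mul]
    congr 1
    · refine integral_congr_ae ?_
      filter_upwards [hfG, hfu] with x h1 h2
      simp only [Finset.sum_const_zero, add_zero] at h2
      rw [show G x = f x from h1.symm, h2]
      split_ifs <;> simp
    · refine integral_congr_ae ?_
      filter_upwards [hVu] with x hx
      simp only [he, hx, add_zero, halfSq_ne_zero]

end H20Approx

/-- the half-space function minimizes `F` in every ball centered at the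
origin, with equality iff `v = u` in `B`. (Here `Δu = 𝟙_{xₙ > 0}` is the weak
Laplacian of `u`.) -/
theorem statement7 (n : ℕ) (hn : 0 < n) (R : ℝ) (hR : 0 < R)
    (v lapv : RH n → ℝ) (hv : MemH2 (ball (0 : RH n) R) v)
    (hv0 : MemH20 (ball (0 : RH n) R) (fun x => v x - uHalf n hn x))
    (hlapv : IsWeakLaplacian (ball (0 : RH n) R) v lapv) :
    ACF (ball (0 : RH n) R)
        (fun x => if 0 < x ⟨n - 1, by omega⟩ then 1 else 0) (uHalf n hn)
      ≤ ACF (ball (0 : RH n) R) lapv v ∧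
    (ACF (ball (0 : RH n) R)
        (fun x => if 0 < x ⟨n - 1, by omega⟩ then 1 else 0) (uHalf n hn)
      = ACF (ball (0 : RH n) R) lapv v ↔
      ∀ᵐ (x : RH n) ∂volume.restrict (ball (0 : RH n) R), v x = uHalf n hn x) := by
  set j : Fin n := ⟨n - 1, by omega⟩ with hj
  obtain ⟨g, h, φ, H⟩ := hv0.exists_approx
  have hu : (fun x : RH n => halfSq (x j)) = uHalf n hn := rfl
  have e : v = fun x => halfSq (x j) + (v x - uHalf n hn x) := by
    funext x
    rw [← congrFun hu x]
    ring
  obtain ⟨hle, heq⟩ := H.le_acf hR j lapv (by rwa [← e])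
  rw [← e] at hle heq
  refine ⟨hle, heq.trans ?_⟩
  simp only [sub_eq_zero]

end
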